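/- Let A ⟶f B ⟶g C ⟶h A⟦1⟧ be a distinguished triangle in C. Then Q(g) is a monomorphism in D if and only if f factors through an object of N. -/

import Mathlib

open CategoryTheory CategoryTheory.Limits CategoryTheory.Pretriangulated

universe v u v₂ u₂

variable {C : Type u} [Category.{v} C] [Preadditive C] [HasZeroObject C]
  [HasShift C ℤ] [∀ n : ℤ, (shiftFunctor C n).Additive] [Pretriangulated C]

/-- `f : X ⟶ Y` factors through an object of `N`. -/
def FactorsThru (N : Set C) {X Y : C} (f : X ⟶ Y) : Prop :=
  ∃ (Z : C) (_ : Z ∈ N) (u : X ⟶ Z) (v : Z ⟶ Y), f = u ≫ v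

/-- The morphism `X⟦-1⟧ ⟶ A` obtained from `h : X ⟶ A⟦1⟧` by shifting by `-1` and
composing with the canonical isomorphism `A⟦1⟧⟦-1⟧ ≅ A`. -/
noncomputable def descShift {X A : C} (h : X ⟶ A⟦(1:ℤ)⟧) : X⟦(-1:ℤ)⟧ ⟶ A :=
  h⟦(-1:ℤ)⟧' ≫ (shiftEquiv C (1:ℤ)).unitIso.inv.app A

/-- The class `S_N` of morphisms fitting in a distinguished triangle whose two other
maps factor through `N`. -/
def SN (N : Set C) {B C₀ : C} (g : B ⟶ C₀) : Prop :=
  ∃ (A : C) (f : A ⟶ B) (h : C₀ ⟶ A⟦(1:ℤ)⟧),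
    (Triangle.mk f g h ∈ distTriang C) ∧ FactorsThru N f ∧ FactorsThru N h

/-- The class `L`. -/
def ClassL (N : Set C) {A B : C} (f : A ⟶ B) : Prop :=
  ∃ (N₀ : C) (_ : N₀ ∈ N) (g : B ⟶ N₀) (h : N₀ ⟶ A⟦(1:ℤ)⟧),
    (Triangle.mk f g h ∈ distTriang C) ∧ FactorsThru N (descShift h)

/-- The class `R`. -/
def ClassR (N : Set C) {B C₀ : C} (g : B ⟶ C₀) : Prop :=
  ∃ (N₀ : C) (_ : N₀ ∈ N) (f : N₀ ⟶ B) (h : C₀ ⟶ N₀⟦(1:ℤ)⟧),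
    (Triangle.mk f g h ∈ distTriang C) ∧ FactorsThru N h

/-- Condition (Lex) on a morphism `h : C₀ ⟶ A⟦1⟧`. -/
def LexCond (N : Set C) {C₀ A : C} (h : C₀ ⟶ A⟦(1:ℤ)⟧) : Prop :=
  ∀ (N₀ : C), N₀ ∈ N → ∀ (x : N₀ ⟶ C₀), FactorsThru N (descShift (x ≫ h))

/-- Condition (Rex) on a morphism `h : C₀ ⟶ A⟦1⟧`. -/
def RexCond (N : Set C) {C₀ A : C} (h : C₀ ⟶ A⟦(1:ℤ)⟧) : Prop :=
  ∀ (N₀ : C), N₀ ∈ N → ∀ (y : A ⟶ N₀),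
    ∃ (M : C) (_ : M ∈ N) (u : C₀⟦(-1:ℤ)⟧ ⟶ M⟦(-1:ℤ)⟧) (v : M⟦(-1:ℤ)⟧ ⟶ N₀),
      descShift h ≫ y = u ≫ v

/-- `S_N` as a morphism property. -/
def SNProp (N : Set C) : MorphismProperty C := fun _ _ g => SN N g


section CalculusOfFractions

variable {E : Type*} [Category* E] {E' : Type*} [Category* E']

/-- A localization functor for a right calculus of fractions is faithful when the inverted
morphisms are epimorphisms. -/
lemma faithful_of_hasRightCalculusOfFractions (L : E ⥤ E') (W : MorphismProperty E)
    [L.IsLocalization W] [W.HasRightCalculusOfFractions]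
    (hW : ∀ ⦃X Y : E⦄ (s : X ⟶ Y), W s → Epi s) : L.Faithful where
  map_injective {X Y a b} hab := by
    obtain ⟨Z, s, hs, fac⟩ := (MorphismProperty.map_eq_iff_precomp L W a b).1 hab
    have := hW s hs
    exact (cancel_epi s).1 fac

/-- A faithful localization functor for a right calculus of fractions preserves monomorphisms. -/
lemma mono_map_of_hasRightCalculusOfFractions (L : E ⥤ E') (W : MorphismProperty E)
    [L.IsLocalization W] [W.HasRightCalculusOfFractions] [L.Faithful] {X Y : E} (g : X ⟶ Y) [Mono g] :
    Mono (L.map g) where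
  right_cancellation {Z} x y hxy := by
    have := Localization.essSurj L W
    let e := L.objObjPreimageIso Z
    obtain ⟨φ, hφ⟩ := Localization.exists_rightFraction L W (e.hom ≫ x)
    obtain ⟨ψ, hψ⟩ := Localization.exists_rightFraction L W (e.hom ≫ y)
    obtain ⟨ρ, hρ⟩ := (MorphismProperty.LeftFraction.mk φ.s ψ.s ψ.hs).exists_rightFraction
    dsimp at hρ
    have hx : L.map φ.s ≫ e.hom ≫ x = L.map φ.f := by rw [hφ]; simp
    have hy : L.map ψ.s ≫ e.hom ≫ y = L.map ψ.f := by rw [hψ]; simp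
    have hρ' : L.map ρ.s ≫ L.map φ.s = L.map ρ.f ≫ L.map ψ.s := by
      simp only [← L.map_comp, hρ]
    have key : ρ.s ≫ φ.f = ρ.f ≫ ψ.f := by
      rw [← cancel_mono g]
      apply L.map_injective
      simp only [L.map_comp, ← hx, ← hy, Category.assoc, hxy]
      rw [reassoc_of% hρ']
    have := Localization.inverts L W ρ.s ρ.hs
    have := Localization.inverts L W φ.s φ.hs
    rw [← cancel_epi e.hom, ← cancel_epi (L.map φ.s), ← cancel_epi (L.map ρ.s), hx,
      reassoc_of% hρ', hy, ← L.map_comp, ← L.map_comp, key]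

end CalculusOfFractions

namespace FactorsThru

variable {E : Type*} [Category* E] {N : Set E}

lemma of_mem_left {X Y : E} (hX : X ∈ N) (f : X ⟶ Y) : FactorsThru N f :=
  ⟨X, hX, 𝟙 X, f, by simp⟩

lemma precomp {X Y Z : E} {g : Y ⟶ Z} (hg : FactorsThru N g) (f : X ⟶ Y) :
    FactorsThru N (f ≫ g) := by
  obtain ⟨M, hM, u, v, rfl⟩ := hg
  exact ⟨M, hM, f ≫ u, v, by simp⟩

lemma postcomp {X Y Z : E} {f : X ⟶ Y} (hf : FactorsThru N f) (g : Y ⟶ Z) :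
    FactorsThru N (f ≫ g) := by
  obtain ⟨M, hM, u, v, rfl⟩ := hf
  exact ⟨M, hM, u, v ≫ g, by simp⟩

lemma neg [Preadditive E] {X Y : E} {f : X ⟶ Y} (hf : FactorsThru N f) :
    FactorsThru N (-f) := by
  obtain ⟨M, hM, u, v, rfl⟩ := hf
  exact ⟨M, hM, u, -v, by simp⟩

lemma zero [Preadditive E] [HasZeroObject E] (hN0 : ∀ X : E, IsZero X → X ∈ N) (X Y : E) :
    FactorsThru N (0 : X ⟶ Y) := by
  obtain ⟨Z, hZ⟩ := HasZeroObject.zero (C := E)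
  exact ⟨Z, hN0 _ hZ, 0, 0, by simp⟩

end FactorsThru

section Triangles

variable {X₁ X₂ X₃ : C} {f : X₁ ⟶ X₂} {g : X₂ ⟶ X₃} {h : X₃ ⟶ X₁⟦(1 : ℤ)⟧}

lemma mor₁_desc (hT : Triangle.mk f g h ∈ distTriang C) {X : C} (a : X₁ ⟶ X)
    (ha : h ≫ a⟦(1 : ℤ)⟧' = 0) : ∃ b : X₂ ⟶ X, a = f ≫ b := by
  obtain ⟨b, hb, _⟩ := complete_distinguished_triangle_morphism₂ _ _ hT
    (contractible_distinguished X) a 0 (ha.trans zero_comp.symm)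
  exact ⟨b, (hb.trans (Category.comp_id a)).symm⟩

lemma mor₂_desc (hT : Triangle.mk f g h ∈ distTriang C) {X : C} (a : X₂ ⟶ X)
    (ha : f ≫ a = 0) : ∃ b : X₃ ⟶ X, a = g ≫ b :=
  Triangle.yoneda_exact₂ _ hT a ha

lemma mor₃_desc (hT : Triangle.mk f g h ∈ distTriang C) {X : C} (a : X₃ ⟶ X)
    (ha : g ≫ a = 0) : ∃ b : X₁⟦(1 : ℤ)⟧ ⟶ X, a = h ≫ b :=
  Triangle.yoneda_exact₃ _ hT a ha

lemma mor₁_lift (hT : Triangle.mk f g h ∈ distTriang C) {X : C} (a : X ⟶ X₂)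
    (ha : a ≫ g = 0) : ∃ b : X ⟶ X₁, a = b ≫ f :=
  Triangle.coyoneda_exact₂ _ hT a ha

lemma mor₂_lift (hT : Triangle.mk f g h ∈ distTriang C) {X : C} (a : X ⟶ X₃)
    (ha : a ≫ h = 0) : ∃ b : X ⟶ X₂, a = b ≫ g :=
  Triangle.coyoneda_exact₃ _ hT a ha

lemma mor₃_lift (hT : Triangle.mk f g h ∈ distTriang C) {X : C} (a : X ⟶ X₁⟦(1 : ℤ)⟧)
    (ha : a ≫ f⟦(1 : ℤ)⟧' = 0) : ∃ b : X ⟶ X₃, a = b ≫ h :=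
  Triangle.coyoneda_exact₁ _ hT a ha

lemma rotate_mem (hT : Triangle.mk f g h ∈ distTriang C) :
    Triangle.mk g h (-f⟦(1 : ℤ)⟧') ∈ distTriang C :=
  rot_of_distTriang _ hT

lemma mor₁_comp_mor₂ (hT : Triangle.mk f g h ∈ distTriang C) : f ≫ g = 0 :=
  comp_distTriang_mor_zero₁₂ _ hT

lemma mor₂_comp_mor₃ (hT : Triangle.mk f g h ∈ distTriang C) : g ≫ h = 0 :=
  comp_distTriang_mor_zero₂₃ _ hT

lemma mor₃_comp_shift_mor₁ (hT : Triangle.mk f g h ∈ distTriang C) : h ≫ f⟦(1 : ℤ)⟧' = 0 :=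
  comp_distTriang_mor_zero₃₁ _ hT

variable {Y₁ Y₂ Y₃ : C} {f' : Y₁ ⟶ Y₂} {g' : Y₂ ⟶ Y₃} {h' : Y₃ ⟶ Y₁⟦(1 : ℤ)⟧}

lemma exists_hom₂ (hT : Triangle.mk f g h ∈ distTriang C)
    (hT' : Triangle.mk f' g' h' ∈ distTriang C) (a : X₁ ⟶ Y₁) (c : X₃ ⟶ Y₃)
    (comm : h ≫ a⟦(1 : ℤ)⟧' = c ≫ h') :
    ∃ b : X₂ ⟶ Y₂, f ≫ b = a ≫ f' ∧ g ≫ c = b ≫ g' :=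
  complete_distinguished_triangle_morphism₂ _ _ hT hT' a c comm

lemma exists_hom₃ (hT : Triangle.mk f g h ∈ distTriang C)
    (hT' : Triangle.mk f' g' h' ∈ distTriang C) (a : X₁ ⟶ Y₁) (b : X₂ ⟶ Y₂)
    (comm : f ≫ b = a ≫ f') :
    ∃ c : X₃ ⟶ Y₃, g ≫ c = b ≫ g' ∧ h ≫ a⟦(1 : ℤ)⟧' = c ≫ h' :=
  complete_distinguished_triangle_morphism _ _ hT hT' a b comm

end Triangles

section ExtensionClosed

variable {N : Set C}
  (hNext : ∀ T : Triangle C, T ∈ distTriang C → T.obj₁ ∈ N → T.obj₃ ∈ N → T.obj₂ ∈ N)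

include hNext

lemma FactorsThru.add {X Y : C} {f g : X ⟶ Y} (hf : FactorsThru N f) (hg : FactorsThru N g) :
    FactorsThru N (f + g) := by
  obtain ⟨M, hM, u, v, rfl⟩ := hf
  obtain ⟨M', hM', u', v', rfl⟩ := hg
  exact ⟨M ⊞ M', hNext _ (binaryBiproductTriangle_distinguished M M') hM hM',
    biprod.lift u u', biprod.desc v v', by simp⟩

variable {A B C₀ : C} {f : A ⟶ B} {g : B ⟶ C₀} {h : C₀ ⟶ A⟦(1 : ℤ)⟧}

/-- If `f` factors through `N` in a distinguished triangle with morphisms `f`, `g`, `h`, then `g`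
is a monomorphism modulo the morphisms factoring through `N`. -/
lemma FactorsThru.of_comp_mor₂ (hT : Triangle.mk f g h ∈ distTriang C) (hf : FactorsThru N f)
    {X : C} {a : X ⟶ B} (ha : FactorsThru N (a ≫ g)) : FactorsThru N a := by
  have hf' := hf
  obtain ⟨N₁, hN₁, u, v, rfl⟩ := hf
  obtain ⟨N₀, hN₀, k, x, hkx⟩ := ha
  obtain ⟨E, i, q, hE⟩ := distinguished_cocone_triangle₂ (x ≫ h)
  obtain ⟨E', j, p, hE'⟩ := distinguished_cocone_triangle₂ ((x ≫ h) ≫ u⟦(1 : ℤ)⟧')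
  obtain ⟨b, hb₁, hb₂⟩ := exists_hom₂ hE hT (𝟙 A) x (by rw [CategoryTheory.Functor.map_id, Category.comp_id])
  obtain ⟨e, he, -⟩ := exists_hom₂ hE hE' u (𝟙 N₀) (Category.id_comp _).symm
  rw [Category.id_comp] at hb₁
  obtain ⟨l, hl⟩ := mor₂_lift hE k (by
    rw [← reassoc_of% hkx, mor₂_comp_mor₃ hT, comp_zero])
  obtain ⟨y, hy⟩ := mor₁_lift hT (a - l ≫ b) (by
    rw [Preadditive.sub_comp, Category.assoc, ← hb₂, hkx, hl, Category.assoc, sub_self])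
  obtain ⟨w, hw⟩ := mor₁_desc hE' v (by
    rw [Category.assoc, Category.assoc, ← Functor.map_comp, mor₃_comp_shift_mor₁ hT, comp_zero])
  obtain ⟨z, hz⟩ := mor₂_desc hE (b - e ≫ w) (by
    rw [Preadditive.comp_sub, hb₁, reassoc_of% he, ← hw, sub_self])
  have hE'N : E' ∈ N := hNext _ hE' hN₁ hN₀
  have hbN : FactorsThru N b := by
    rw [← sub_add_cancel b (e ≫ w), hz]
    exact .add hNext ((of_mem_left hN₀ z).precomp q) ((of_mem_left hE'N w).precomp e)
  rw [← sub_add_cancel a (l ≫ b), hy]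
  exact .add hNext (hf'.precomp y) (hbN.precomp l)

/-- If `h` factors through `N` in a distinguished triangle with morphisms `f`, `g`, `h`, then `g`
is an epimorphism modulo the morphisms factoring through `N`. -/
lemma FactorsThru.of_mor₂_comp (hT : Triangle.mk f g h ∈ distTriang C) (hh : FactorsThru N h)
    {Y : C} {b : C₀ ⟶ Y} (hb : FactorsThru N (g ≫ b)) : FactorsThru N b := by
  have hh' := hh
  obtain ⟨N₁, hN₁, k, v, rfl⟩ := hh
  obtain ⟨M, hM, m, n, hmn⟩ := hb
  obtain ⟨E, j, p, hE⟩ := distinguished_cocone_triangle (f ≫ m)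
  obtain ⟨E', j', p', hE'⟩ := distinguished_cocone_triangle₂ (v ≫ (-(f ≫ m)⟦(1 : ℤ)⟧'))
  obtain ⟨c, hc₁, hc₂⟩ := exists_hom₃ hT hE (𝟙 A) m (Category.id_comp _).symm
  rw [CategoryTheory.Functor.map_id, Category.comp_id] at hc₂
  obtain ⟨e, -, he⟩ := exists_hom₂ hE' (rotate_mem hE) (𝟙 M) v
    (by rw [CategoryTheory.Functor.map_id, Category.comp_id])
  obtain ⟨l, hl⟩ := mor₂_lift hE' k (by
    have := mor₃_comp_shift_mor₁ hT
    rw [Category.assoc] at this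
    rw [Functor.map_comp, Preadditive.comp_neg, Preadditive.comp_neg, reassoc_of% this,
      zero_comp, neg_zero])
  obtain ⟨w, hw⟩ := mor₂_desc hE n (by
    rw [Category.assoc, ← hmn, ← Category.assoc, mor₁_comp_mor₂ hT, zero_comp])
  obtain ⟨t, ht⟩ := mor₁_lift (rotate_mem hE) (c - l ≫ e) (by
    rw [Preadditive.sub_comp, Category.assoc, ← he, ← hc₂, reassoc_of% hl, sub_self])
  obtain ⟨z, hz⟩ := mor₃_desc hT (b - c ≫ w) (by
    rw [Preadditive.comp_sub, hmn, reassoc_of% hc₁, ← hw, sub_self])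
  have hE'N : E' ∈ N := hNext _ hE' hM hN₁
  have hc : FactorsThru N c := by
    rw [← sub_add_cancel c (l ≫ e), ht]
    exact .add hNext ((of_mem_left hM j).precomp t) ((of_mem_left hE'N e).precomp l)
  rw [← sub_add_cancel b (c ≫ w), hz]
  exact .add hNext (hh'.postcomp z) (hc.postcomp w)

/-- The right Ore condition for `S_N`, modulo the morphisms factoring through `N`. -/
lemma SN.exists_square {X : C} {s : B ⟶ C₀} (hs : SN N s) (a : X ⟶ C₀) :
    ∃ (P : C) (t : P ⟶ X) (b : P ⟶ B), SN N t ∧ FactorsThru N (t ≫ a - b ≫ s) := by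
  obtain ⟨A, f, h, hT, ⟨N₀, hN₀, u, v, rfl⟩, ⟨N₁, hN₁, k, l, rfl⟩⟩ := hs
  obtain ⟨P, i, t, hP⟩ := distinguished_cocone_triangle₂ (a ≫ (k ≫ l) ≫ u⟦(1 : ℤ)⟧')
  obtain ⟨E, j, p, hE⟩ := distinguished_cocone_triangle₂ (l ≫ u⟦(1 : ℤ)⟧')
  have hEN : E ∈ N := hNext _ hE hN₀ hN₁
  obtain ⟨c, hc⟩ := mor₂_lift hE (t ≫ a ≫ k) (by
    simpa using mor₂_comp_mor₃ hP)
  obtain ⟨x, hx⟩ := mor₃_lift hT (p ≫ l) (by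
    have := mor₂_comp_mor₃ hE
    rw [Functor.map_comp, Category.assoc, reassoc_of% this, zero_comp])
  obtain ⟨b, hb⟩ := mor₂_lift hT (t ≫ a - c ≫ x) (by
    rw [Preadditive.sub_comp, sub_eq_zero, Category.assoc, Category.assoc, ← hx,
      ← reassoc_of% hc])
  refine ⟨P, t, b, ⟨N₀, i, _, hP, .of_mem_left hN₀ i, ?_⟩, ?_⟩
  · exact ((FactorsThru.postcomp ⟨N₁, hN₁, k, l, rfl⟩ _).precomp a)
  · rw [← hb, sub_sub_cancel]
    exact (FactorsThru.of_mem_left hEN x).precomp c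

end ExtensionClosed

section Quotient

/-- Two parallel morphisms are related when their difference factors through `N`. -/
def idealRel (N : Set C) : HomRel C := fun _ _ f g => FactorsThru N (f - g)

/-- The multiplicative closure of the image of `S_N` in the quotient of `C` by the ideal of
morphisms factoring through `N`. -/
def quotientSN (N : Set C) : MorphismProperty (Quotient (idealRel N)) :=
  ((SNProp N).strictMap (Quotient.functor (idealRel N))).multiplicativeClosure

instance (N : Set C) : (quotientSN N).IsMultiplicative :=
  inferInstanceAs (MorphismProperty.multiplicativeClosure _).IsMultiplicative

variable {N : Set C}

lemma quotientSN_functor_map {X Y : C} {s : X ⟶ Y} (hs : SN N s) :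
    quotientSN N ((Quotient.functor (idealRel N)).map s) :=
  .of _ (.map hs)

variable (hN0 : ∀ X : C, IsZero X → X ∈ N)
  (hNext : ∀ T : Triangle C, T ∈ distTriang C → T.obj₁ ∈ N → T.obj₃ ∈ N → T.obj₂ ∈ N)

include hN0 hNext

lemma congruence_idealRel : Congruence (idealRel N) where
  comp_left f g g' hg := by
    change FactorsThru N _
    rw [← Preadditive.comp_sub]
    exact FactorsThru.precomp hg f
  comp_right {_ _ _ f f'} g hf := by
    change FactorsThru N _
    rw [← Preadditive.sub_comp]
    exact FactorsThru.postcomp hf g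
  equivalence :=
    { refl f := by
        change FactorsThru N _
        rw [sub_self]
        exact .zero hN0 _ _
      symm {f g} hfg := by
        change FactorsThru N _
        rw [← neg_sub]
        exact FactorsThru.neg hfg
      trans {f g k} hfg hgk := by
        change FactorsThru N _
        rw [← sub_add_sub_cancel f g k]
        exact FactorsThru.add hNext hfg hgk }

lemma map_eq_map_iff {X Y : C} (f g : X ⟶ Y) :
    (Quotient.functor (idealRel N)).map f = (Quotient.functor (idealRel N)).map g ↔
      FactorsThru N (f - g) :=
  have := congruence_idealRel hN0 hNext
  Quotient.functor_map_eq_iff _ _ _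

variable {A B C₀ : C} {f : A ⟶ B} {g : B ⟶ C₀} {h : C₀ ⟶ A⟦(1 : ℤ)⟧}

lemma mono_quotientFunctor_map (hT : Triangle.mk f g h ∈ distTriang C) (hf : FactorsThru N f) :
    Mono ((Quotient.functor (idealRel N)).map g) where
  right_cancellation {Z} a b hab := by
    obtain ⟨a, rfl⟩ := (Quotient.functor (idealRel N)).map_surjective (X := Z.as) a
    obtain ⟨b, rfl⟩ := (Quotient.functor (idealRel N)).map_surjective (X := Z.as) b
    rw [← Functor.map_comp, ← Functor.map_comp, map_eq_map_iff hN0 hNext,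
      ← Preadditive.sub_comp] at hab
    exact (map_eq_map_iff hN0 hNext _ _).2 (.of_comp_mor₂ hNext hT hf hab)

lemma epi_quotientFunctor_map (hT : Triangle.mk f g h ∈ distTriang C) (hh : FactorsThru N h) :
    Epi ((Quotient.functor (idealRel N)).map g) where
  left_cancellation {Z} a b hab := by
    obtain ⟨a, rfl⟩ := (Quotient.functor (idealRel N)).map_surjective (Y := Z.as) a
    obtain ⟨b, rfl⟩ := (Quotient.functor (idealRel N)).map_surjective (Y := Z.as) b
    rw [← Functor.map_comp, ← Functor.map_comp, map_eq_map_iff hN0 hNext,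
      ← Preadditive.comp_sub] at hab
    exact (map_eq_map_iff hN0 hNext _ _).2 (.of_mor₂_comp hNext hT hh hab)

lemma quotientSN_le_monomorphisms :
    quotientSN N ≤ MorphismProperty.monomorphisms (Quotient (idealRel N)) := by
  rw [quotientSN, MorphismProperty.multiplicativeClosure_le_iff]
  rintro _ _ _ ⟨⟨A, f, h, hT, hf, -⟩⟩
  exact mono_quotientFunctor_map hN0 hNext hT hf

lemma quotientSN_le_epimorphisms :
    quotientSN N ≤ MorphismProperty.epimorphisms (Quotient (idealRel N)) := by
  rw [quotientSN, MorphismProperty.multiplicativeClosure_le_iff]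
  rintro _ _ _ ⟨⟨A, f, h, hT, -, hh⟩⟩
  exact epi_quotientFunctor_map hN0 hNext hT hh

lemma quotientSN.exists_square {Y Y' : Quotient (idealRel N)} {s : Y ⟶ Y'}
    (hs : quotientSN N s) {X : Quotient (idealRel N)} (a : X ⟶ Y') :
    ∃ (P : Quotient (idealRel N)) (t : P ⟶ X) (b : P ⟶ Y), quotientSN N t ∧ t ≫ a = b ≫ s := by
  have step : ∀ {Y Y' : Quotient (idealRel N)} {s : Y ⟶ Y'},
      (SNProp N).strictMap (Quotient.functor (idealRel N)) s →
      ∀ {X : Quotient (idealRel N)} (a : X ⟶ Y'),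
        ∃ (P : Quotient (idealRel N)) (t : P ⟶ X) (b : P ⟶ Y),
          quotientSN N t ∧ t ≫ a = b ≫ s := by
    rintro _ _ _ ⟨hs⟩ X a
    obtain ⟨a, rfl⟩ := (Quotient.functor (idealRel N)).map_surjective (X := X.as) a
    obtain ⟨P, t, b, ht, hab⟩ := SN.exists_square hNext hs a
    refine ⟨_, (Quotient.functor (idealRel N)).map t, (Quotient.functor (idealRel N)).map b,
      quotientSN_functor_map ht, ?_⟩
    rw [← Functor.map_comp, ← Functor.map_comp, map_eq_map_iff hN0 hNext]
    exact hab
  induction hs generalizing X with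
  | of s hs => exact step hs a
  | id Y => exact ⟨X, 𝟙 X, a, .id X, by simp⟩
  | comp_of s s' _ hs' ih =>
    obtain ⟨P, t, b, ht, hab⟩ := step hs' a
    obtain ⟨P', t', b', ht', hab'⟩ := ih b
    exact ⟨P', t' ≫ t, b', MorphismProperty.comp_mem _ _ _ ht' ht, by
      rw [Category.assoc, hab, reassoc_of% hab']⟩

lemma hasRightCalculusOfFractions_quotientSN :
    (quotientSN N).HasRightCalculusOfFractions where
  exists_rightFraction X Y φ := by
    obtain ⟨P, t, b, ht, hab⟩ := quotientSN.exists_square hN0 hNext φ.hs φ.f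
    exact ⟨.mk t ht b, hab⟩
  ext X Y Y' a b s hs hab := by
    have : Mono s := quotientSN_le_monomorphisms hN0 hNext s hs
    exact ⟨X, 𝟙 X, MorphismProperty.id_mem _ _, by rw [(cancel_mono s).1 hab]⟩

end Quotient

section Localization

variable {N : Set C} {D : Type u₂} [Category.{v₂} D]

open ZeroObject in
/-- An additive functor inverting `S_N` kills the morphisms which factor through `N`. -/
lemma FactorsThru.map_eq_zero (hN0 : ∀ X : C, IsZero X → X ∈ N) [Preadditive D] (Q : C ⥤ D)
    [Q.Additive] (hQ : (SNProp N).IsInvertedBy Q) {X Y : C} {f : X ⟶ Y}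
    (hf : FactorsThru N f) : Q.map f = 0 := by
  obtain ⟨Z, hZ, u, v, rfl⟩ := hf
  have : IsIso (Q.map (0 : Z ⟶ 0)) := hQ _ ⟨Z, 𝟙 Z, 0, contractible_distinguished Z,
    .of_mem_left hZ _, .zero hN0 _ _⟩
  have hu : Q.map u = 0 := by
    rw [← cancel_mono (Q.map (0 : Z ⟶ 0)), ← Q.map_comp, comp_zero, zero_comp, Q.map_zero]
  rw [Q.map_comp, hu, zero_comp]

lemma isInvertedBy_quotientFunctor_comp_Q :
    (SNProp N).IsInvertedBy (Quotient.functor (idealRel N) ⋙ (quotientSN N).Q) :=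
  fun _ _ _ hs ↦ (quotientSN N).Q_inverts _ (quotientSN_functor_map hs)

end Localization

theorem stmt10 (N : Set C)
    (hN0 : ∀ X : C, Limits.IsZero X → X ∈ N)
    (hNiso : ∀ ⦃X Y : C⦄, (X ≅ Y) → X ∈ N → Y ∈ N)
    (hNsum : ∀ ⦃X Z : C⦄ (i : X ⟶ Z) (r : Z ⟶ X), i ≫ r = 𝟙 X → Z ∈ N → X ∈ N)
    (hNext : ∀ (T : Triangle C), (T ∈ distTriang C) → T.obj₁ ∈ N → T.obj₃ ∈ N → T.obj₂ ∈ N)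
    {D : Type u₂} [Category.{v₂} D] [Preadditive D] [HasZeroObject D]
    (Q : C ⥤ D) [Q.Additive] [Q.IsLocalization (SNProp N)]
    {A B C₀ : C} (f : A ⟶ B) (g : B ⟶ C₀) (h : C₀ ⟶ A⟦(1:ℤ)⟧)
    (hT : Triangle.mk f g h ∈ distTriang C) :
    Mono (Q.map g) ↔ FactorsThru N f := by
  have hcalc := hasRightCalculusOfFractions_quotientSN hN0 hNext
  let π := Quotient.functor (idealRel N)
  let W := quotientSN N
  have hfaithful : W.Q.Faithful := faithful_of_hasRightCalculusOfFractions W.Q W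
    (quotientSN_le_epimorphisms hN0 hNext)
  let G : D ⥤ W.Localization :=
    Localization.lift (π ⋙ W.Q) isInvertedBy_quotientFunctor_comp_Q Q
  let eG : Q ⋙ G ≅ π ⋙ W.Q := Localization.fac _ _ _
  constructor
  · intro hg
    have hQf : Q.map f = Q.map 0 := by
      rw [← cancel_mono (Q.map g), ← Q.map_comp, ← Q.map_comp, mor₁_comp_mor₂ hT, zero_comp]
    have hπf : π.map f = π.map 0 := by
      apply W.Q.map_injective
      have h₁ := eG.inv.naturality f
      have h₂ := eG.inv.naturality (0 : A ⟶ B)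
      rw [← cancel_mono (eG.inv.app B)]
      exact h₁.trans (Eq.trans (by dsimp; rw [hQf]) h₂.symm)
    simpa using (map_eq_map_iff hN0 hNext f 0).1 hπf
  · intro hf
    have hQ := Localization.inverts Q (SNProp N)
    let Q' : Quotient (idealRel N) ⥤ D := CategoryTheory.Quotient.lift _ Q fun _ _ a b hab ↦ by
      rw [← sub_eq_zero, ← Q.map_sub, FactorsThru.map_eq_zero hN0 Q hQ hab]
    have hQ' : W.IsInvertedBy Q' := by
      rw [MorphismProperty.IsInvertedBy.iff_le_inverseImage_isomorphisms]
      refine (MorphismProperty.multiplicativeClosure_le_iff _ _).2 ?_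
      rintro _ _ _ ⟨hs⟩
      exact hQ _ hs
    let H : W.Localization ⥤ D := Localization.lift Q' hQ' W.Q
    let eH : W.Q ⋙ H ≅ Q' := Localization.fac _ _ _
    let e : Q ⋙ G ⋙ H ≅ Q :=
      Functor.isoWhiskerRight eG H ≪≫ Functor.isoWhiskerLeft π eH
    let : Localization.Lifting Q (SNProp N) Q (G ⋙ H) := ⟨e⟩
    let e' : G ⋙ H ≅ 𝟭 D := Localization.liftNatIso Q (SNProp N) Q Q _ _ (Iso.refl Q)
    have : (G ⋙ H).Faithful := .of_iso e'.symm
    have : G.Faithful := .of_comp G H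
    have := mono_quotientFunctor_map hN0 hNext hT hf
    have := mono_map_of_hasRightCalculusOfFractions W.Q W (π.map g)
    refine G.mono_of_mono_map ?_
    exact ((MorphismProperty.monomorphisms _).arrow_mk_iso_iff
      ((Functor.mapArrowFunctor _ _).mapIso eG |>.app (Arrow.mk g))).2 this
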